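/- Let E be a separable complex Hilbert space and let Q be a closed subspace of the E-valued Hardy space H²_E(𝔻) with {0} ⊊ Q ⊊ H²_E(𝔻) which is invariant under M_z* (the adjoint of the shift M_z). Let S_Q = P_Q M_z|_Q be the compression of M_z to Q. Then there exists a nonzero f ∈ Q with f(0) = 0 if and only if S_Q is norm-attaining and ‖S_Q‖ = 1. -/

import Mathlib

noncomputable section

/-- A bounded operator attains its norm if `‖T f‖ = ‖T‖ * ‖f‖` for some nonzero `f`. -/
def NormAttaining {E F : Type*} [NormedAddCommGroup E] [NormedSpace ℂ E]
    [NormedAddCommGroup F] [NormedSpace ℂ F] (T : E →L[ℂ] F) : Prop :=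
  ∃ f : E, f ≠ 0 ∧ ‖T f‖ = ‖T‖ * ‖f‖

/-- The `E`-valued Hardy space `H²_E(𝔻)`, realized via Taylor coefficients as `ℓ²(ℕ, E)`.
An element `f` is the function `z ↦ ∑ₙ (f n) zⁿ`; in particular `f 0` is its value at `0`. -/
abbrev HardySeq (E : Type*) [NormedAddCommGroup E] : Type _ := lp (fun _ : ℕ => E) 2

lemma hardy_norm_sq {E : Type} [NormedAddCommGroup E] (f : HardySeq E) :
    HasSum (fun n => ‖f n‖ ^ 2) (‖f‖ ^ 2) := by
  have h := lp.hasSum_norm (p := 2) (by norm_num) f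
  simpa using h

lemma shift_norm {E : Type} [NormedAddCommGroup E] [InnerProductSpace ℂ E]
    (Mz : HardySeq E →L[ℂ] HardySeq E)
    (hMz : ∀ f : HardySeq E, Mz f 0 = 0 ∧ ∀ n : ℕ, Mz f (n + 1) = f n) (f : HardySeq E) :
    ‖Mz f‖ = ‖f‖ := by
  have h1 := (hasSum_nat_add_iff' 1).2 (hardy_norm_sq (Mz f))
  simp only [(hMz f).2, Finset.sum_range_one, (hMz f).1, norm_zero] at h1
  have h2 := h1.unique (hardy_norm_sq f)
  rw [← sq_eq_sq₀ (norm_nonneg _) (norm_nonneg _)]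
  linarith

lemma shift_surj {E : Type} [NormedAddCommGroup E] [InnerProductSpace ℂ E]
    (Mz : HardySeq E →L[ℂ] HardySeq E)
    (hMz : ∀ f : HardySeq E, Mz f 0 = 0 ∧ ∀ n : ℕ, Mz f (n + 1) = f n) (f : HardySeq E)
    (hf : f 0 = 0) : ∃ g, Mz g = f := by
  have hm : Memℓp (fun n => f (n + 1)) 2 := by
    apply memℓp_gen
    have := (summable_nat_add_iff 1).2 (hardy_norm_sq f).summable
    simpa using this
  refine ⟨⟨fun n => f (n + 1), hm⟩, ?_⟩
  ext n
  cases n with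
  | zero => rw [(hMz _).1, hf]
  | succ n => rw [(hMz _).2]

/-- Let `Q` be a nonzero proper closed `M_z^*`-invariant subspace of the `E`-valued Hardy
space (here realized as `ℓ²(ℕ, E)`, with `Mz` the shift, `P` the orthogonal projection onto
`Q`, and `SQ = P_Q M_z |_Q` the Sz.-Nagy--Foiaş model operator).  Then there is a nonzero
`f ∈ Q` with `f(0) = 0` if and only if `SQ` is norm-attaining and `‖SQ‖ = 1`. -/
theorem model_operator_normAttaining_norm_one_iff
    {E : Type} [NormedAddCommGroup E] [InnerProductSpace ℂ E] [CompleteSpace E]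
    [TopologicalSpace.SeparableSpace E]
    (Mz : HardySeq E →L[ℂ] HardySeq E)
    (hMz : ∀ f : HardySeq E, Mz f 0 = 0 ∧ ∀ n : ℕ, Mz f (n + 1) = f n)
    (Q : Submodule ℂ (HardySeq E)) (hQbot : Q ≠ ⊥) (hQtop : Q ≠ ⊤)
    (hQclosed : IsClosed (Q : Set (HardySeq E)))
    (hQinv : ∀ f ∈ Q, ContinuousLinearMap.adjoint Mz f ∈ Q)
    (P : HardySeq E →L[ℂ] HardySeq E)
    (hPmem : ∀ f, P f ∈ Q) (hPid : ∀ f ∈ Q, P f = f) (hPorth : ∀ f, f - P f ∈ Qᗮ)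
    (SQ : Q →L[ℂ] Q) (hSQ : ∀ f : Q, (SQ f : HardySeq E) = P (Mz f)) :
    (∃ f : HardySeq E, f ∈ Q ∧ f ≠ 0 ∧ f 0 = 0) ↔
      (NormAttaining SQ ∧ ‖SQ‖ = 1) := by
  have hiso : ∀ f : HardySeq E, ‖Mz f‖ = ‖f‖ := shift_norm Mz hMz
  have hpyth : ∀ f : HardySeq E, ‖f‖ ^ 2 = ‖P f‖ ^ 2 + ‖f - P f‖ ^ 2 := by
    intro f
    have h0 : inner ℂ (P f) (f - P f) = 0 := (Submodule.mem_orthogonal Q _).1 (hPorth f) _ (hPmem f)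
    have h1 := norm_add_sq_eq_norm_sq_add_norm_sq_of_inner_eq_zero (𝕜 := ℂ) (P f) (f - P f) h0
    rw [add_sub_cancel] at h1
    nlinarith [h1]
  have hPle : ∀ f : HardySeq E, ‖P f‖ ≤ ‖f‖ := by
    intro f
    have := hpyth f
    exact le_of_sq_le_sq (by nlinarith [sq_nonneg ‖f - P f‖]) (norm_nonneg _)
  have hSn : ∀ f : Q, ‖SQ f‖ = ‖P (Mz f)‖ := fun f => by
    rw [← hSQ f]
    rfl
  have hQn : ∀ f : Q, ‖f‖ = ‖Mz (f : HardySeq E)‖ := fun f => by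
    rw [hiso]
    rfl
  have hSle : ‖SQ‖ ≤ 1 := by
    refine ContinuousLinearMap.opNorm_le_bound _ zero_le_one fun f => ?_
    rw [one_mul, hSn, hQn]
    exact hPle _
  constructor
  · rintro ⟨f, hfQ, hf0, hfz⟩
    obtain ⟨g, hg⟩ := shift_surj Mz hMz f hfz
    have hadj : ContinuousLinearMap.adjoint Mz f = g := by
      rw [← hg, ← ContinuousLinearMap.comp_apply,
        (ContinuousLinearMap.norm_map_iff_adjoint_comp_self Mz).1 hiso]
      rfl
    have hgQ : g ∈ Q := hadj ▸ hQinv f hfQ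
    have hgn : ‖g‖ = ‖f‖ := by rw [← hg, hiso]
    have hg0 : g ≠ 0 := by
      intro h
      rw [h, map_zero] at hg
      exact hf0 hg.symm
    have hS : ‖SQ ⟨g, hgQ⟩‖ = ‖(⟨g, hgQ⟩ : Q)‖ := by
      rw [hSn, hQn]
      simp only [hg, hPid f hfQ]
    have hne : (⟨g, hgQ⟩ : Q) ≠ 0 := fun h => hg0 (congrArg Subtype.val h)
    have h1 : ‖SQ‖ = 1 := by
      refine le_antisymm hSle ?_
      have h2 := SQ.le_opNorm ⟨g, hgQ⟩
      rw [hS] at h2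
      have h3 : 0 < ‖(⟨g, hgQ⟩ : Q)‖ := norm_pos_iff.2 hne
      nlinarith
    exact ⟨⟨_, hne, by rw [h1, one_mul, hS]⟩, h1⟩
  · rintro ⟨⟨f, hf0, hf⟩, h1⟩
    rw [h1, one_mul, hSn, hQn] at hf
    have h2 := hpyth (Mz f)
    rw [hf] at h2
    have h3 : ‖Mz (f : HardySeq E) - P (Mz f)‖ = 0 := by
      have : ‖Mz (f : HardySeq E) - P (Mz f)‖ ^ 2 = 0 := by linarith
      exact pow_eq_zero_iff (two_ne_zero) |>.1 this
    have h4 : Mz (f : HardySeq E) = P (Mz f) := sub_eq_zero.1 (norm_eq_zero.1 h3)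
    refine ⟨Mz f, h4 ▸ hPmem _, ?_, (hMz _).1⟩
    intro h
    apply hf0
    have := hiso f
    rw [h, norm_zero] at this
    exact Subtype.ext (norm_eq_zero.1 this.symm)

end
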